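/- Let q = 2^s. The variety in V̄ = V ⊗ F̄_q cut out by the symplectic invariants ξ_1, ..., ξ_m equals the union over g ∈ O_{2m+1}(F_q) of the translates g·V(y_1,...,y_m) of the maximal isotropic coordinate subspace: V(ξ_1,...,ξ_m) = ∪_{g} g·V(y_1,...,y_m). -/

import Mathlib

open MvPolynomial

/-- Variable index set for `S_m[z] = F_q[y_1,…,y_m,x_m,…,x_1,z]`:
`none` is `z`, `some (inl j)` is `y_j`, `some (inr j)` is `x_j`. -/
abbrev OIdx (m : ℕ) := Option (Fin m ⊕ Fin m)

/-- The action of an invertible linear map `g` of `V = ι → F` on the polynomial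
ring on `V`, so that `eval v (act g f) = eval (g v) f`. -/
noncomputable def act {F : Type*} [Field F] {ι : Type*} [Fintype ι] [DecidableEq ι]
    (g : (ι → F) ≃ₗ[F] (ι → F)) : MvPolynomial ι F →ₐ[F] MvPolynomial ι F :=
  MvPolynomial.aeval fun i => ∑ j, MvPolynomial.C (g (Pi.single j 1) i) * MvPolynomial.X j

/-- The quadratic form `ξ_0 = z^2 + Σ x_j y_j`. -/
noncomputable def xiZero (m : ℕ) (F : Type*) [Field F] : MvPolynomial (OIdx m) F :=
  X none ^ 2 + ∑ j : Fin m, X (some (Sum.inr j)) * X (some (Sum.inl j))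

/-- `ξ_i = Σ_j (x_j y_j^{q^i} + y_j x_j^{q^i})` for `i ≥ 1`. -/
noncomputable def xiGen (q m : ℕ) (F : Type*) [Field F] (i : ℕ) : MvPolynomial (OIdx m) F :=
  ∑ j : Fin m, (X (some (Sum.inr j)) * X (some (Sum.inl j)) ^ q ^ i
    + X (some (Sum.inl j)) * X (some (Sum.inr j)) ^ q ^ i)

/-- Moore's criterion: if `a` is linearly independent over a finite field of order `q`, then
the vectors `(a_l ^ q ^ n)_l` for `n < N`, with `N` at least the length of `a`, have no common
nontrivial annihilator. -/
theorem eq_zero_of_sum_mul_pow_card_pow_eq_zero {F K ι : Type*} [Field F] [Fintype F] [Field K]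
    [Algebra F K] [Fintype ι] {a : ι → K} (ha : LinearIndependent F a) {c : ι → K} {N : ℕ}
    (hN : Fintype.card ι ≤ N)
    (h : ∀ n < N, ∑ l, c l * a l ^ Fintype.card F ^ n = 0) : c = 0 := by
  classical
  set q := Fintype.card F with hq
  have hq1 : 1 < q := Fintype.one_lt_card
  let r := Fintype.card ι
  let e : ι ≃ Fin r := Fintype.equivFin ι
  let M : Matrix ι ι K := Matrix.of fun n l => a l ^ q ^ (e n : ℕ)
  by_contra hc
  have hMc : M.mulVec c = 0 := by
    ext n
    have := h (e n) ((e n).2.trans_le hN)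
    simpa [M, Matrix.mulVec, dotProduct, mul_comm] using this
  obtain ⟨d, hd0, hd⟩ := Matrix.exists_vecMul_eq_zero_iff.mpr
    (Matrix.exists_mulVec_eq_zero_iff.mp ⟨c, hc, hMc⟩)
  have hda : ∀ l, ∑ n, d n * a l ^ q ^ (e n : ℕ) = 0 := fun l => by
    simpa [M, Matrix.vecMul, dotProduct] using congrFun hd l
  let P : Polynomial K := ∑ n, Polynomial.monomial (q ^ (e n : ℕ)) (d n)
  have hinj : Function.Injective fun n : ι => q ^ (e n : ℕ) :=
    (Nat.pow_right_injective hq1).comp (Fin.val_injective.comp e.injective)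
  have hcoeff : ∀ n, P.coeff (q ^ (e n : ℕ)) = d n := fun n => by
    simp only [P, Polynomial.finsetSum_coeff, Polynomial.coeff_monomial, hinj.eq_iff]
    simp
  have hP : P = 0 := by
    refine Polynomial.eq_zero_of_natDegree_lt_card_of_eval_eq_zero P
      (f := fun t : ι → F => ∑ l, t l • a l) ?_ ?_ ?_
    · exact fun _ _ h => funext (Fintype.linearIndependent_iffₛ.mp ha _ _ h)
    · intro t
      have hpow : ∀ n : ℕ, (∑ l, t l • a l) ^ q ^ n = ∑ l, t l • a l ^ q ^ n := fun n => by
        have := map_sum (FiniteField.frobeniusAlgHom F K ^ n) (fun l => t l • a l) Finset.univ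
        simpa only [map_smul, AlgHom.coe_pow, FiniteField.coe_frobeniusAlgHom, pow_iterate]
          using this
      simp only [P, Polynomial.eval_finsetSum, Polynomial.eval_monomial, hpow, Finset.mul_sum,
        mul_smul_comm]
      rw [Finset.sum_comm]
      simp only [← Finset.smul_sum, hda, smul_zero, Finset.sum_const_zero]
    · rw [Fintype.card_fun]
      have hpos : 0 < q ^ r := by positivity
      refine (Nat.lt_of_le_pred hpos ?_)
      refine Polynomial.natDegree_sum_le_of_forall_le _ _ fun n _ => ?_
      refine (Polynomial.natDegree_monomial_le _).trans (Nat.le_pred_of_lt ?_)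
      exact Nat.pow_lt_pow_right hq1 (e n).2
  exact hd0 (funext fun n => by simpa [hP] using (hcoeff n).symm)

/-- In a nondegenerate alternating space, a hyperbolic family of any length allowed by the
dimension can be chosen with one half orthogonal to a given isotropic subspace. -/
theorem exists_hyperbolic_family {F E : Type*} [Field F] [AddCommGroup E] [Module F E]
    [FiniteDimensional F E] (B : LinearMap.BilinForm F E) (hB : B.IsAlt)
    (hnd : ∀ x, (∀ y, B x y = 0) → x = 0) (W : Submodule F E)
    (hW : ∀ x ∈ W, ∀ y ∈ W, B x y = 0) (k : ℕ) (hk : 2 * k ≤ Module.finrank F E) :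
    ∃ p q : Fin k → E, (∀ i j, B (p i) (p j) = 0) ∧ (∀ i j, B (q i) (q j) = 0) ∧
      (∀ i j, B (p i) (q j) = if i = j then 1 else 0) ∧ ∀ i, ∀ w ∈ W, B (p i) w = 0 := by
  have hneg : ∀ x y, B x y = -B y x := fun x y => (hB.neg_eq y x).symm
  induction k with
  | zero => exact ⟨Fin.elim0, Fin.elim0, fun i => i.elim0, fun i => i.elim0, fun i => i.elim0,
      fun i => i.elim0⟩
  | succ k ih =>
    obtain ⟨p, q, hpp, hqq, hpq, hpW⟩ := ih (by omega)
    have hqp : ∀ i j, B (q i) (p j) = -if j = i then 1 else 0 := fun i j => by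
      rw [hneg, hpq]
    let D : E → E := fun v => v - ∑ i, (B v (q i) • p i - B v (p i) • q i)
    have hDp : ∀ v j, B (D v) (p j) = 0 := fun v j => by
      simp [D, hpp, hqp]
    have hDq : ∀ v j, B (D v) (q j) = 0 := fun v j => by
      simp [D, hpq, hqq]
    have hD : ∀ x v, B (D x) (D v) = B (D x) v := fun x v => by
      simp only [D] at hDp hDq ⊢
      rw [map_sub (B _), map_sum (B _)]
      simp only [map_sub (B _), map_smul (B _), hDp, hDq]
      simp
    obtain ⟨e, he0, heW⟩ : ∃ v, D v ≠ 0 ∧ ∀ w ∈ W, B (D v) w = 0 := by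
      by_cases hex : ∃ v ∈ W, D v ≠ 0
      · obtain ⟨v, hv, hDv⟩ := hex
        refine ⟨v, hDv, fun w hw => ?_⟩
        have hvp : ∀ i, B v (p i) = 0 := fun i => by rw [hneg, hpW i v hv, neg_zero]
        simp [D, hvp, hpW _ w hw, hW v hv w hw]
      · push Not at hex
        obtain ⟨v, hv⟩ : ∃ v, D v ≠ 0 := by
          by_contra! hall
          have htop : Submodule.span F (Set.range (Sum.elim p q)) = ⊤ := by
            rw [eq_top_iff]
            intro v _
            rw [sub_eq_zero.mp (hall v)]
            refine Submodule.sum_mem _ fun i _ => Submodule.sub_mem _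
              (Submodule.smul_mem _ _ (Submodule.subset_span ⟨Sum.inl i, rfl⟩))
              (Submodule.smul_mem _ _ (Submodule.subset_span ⟨Sum.inr i, rfl⟩))
          have hle := finrank_range_le_card (R := F) (Sum.elim p q)
          rw [Set.finrank, htop, finrank_top] at hle
          simp at hle
          omega
        refine ⟨v, hv, fun w hw => ?_⟩
        rw [← hD, hex w hw, map_zero]
    obtain ⟨f, hf⟩ : ∃ f, B (D e) f ≠ 0 := by
      by_contra! hall
      exact he0 (hnd _ hall)
    let f' := (B (D e) f)⁻¹ • D f
    have hef : B (D e) f' = 1 := by simp [f', hD, hf]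
    have hpe : ∀ i, B (p i) (D e) = 0 := fun i => by rw [hneg, hDp, neg_zero]
    have hpf : ∀ i, B (p i) f' = 0 := fun i => by rw [hneg]; simp [f', hDp]
    have hqf : ∀ i, B (q i) f' = 0 := fun i => by rw [hneg]; simp [f', hDq]
    have hfq : ∀ i, B f' (q i) = 0 := fun i => by simp [f', hDq]
    refine ⟨Fin.cons (D e) p, Fin.cons f' q, ?_, ?_, ?_, ?_⟩
    · intro i j
      cases i using Fin.cases <;> cases j using Fin.cases <;> simp [hB.self_eq_zero, hDp, hpp, hpe]
    · intro i j
      cases i using Fin.cases <;> cases j using Fin.cases <;> simp [hB.self_eq_zero, hqq, hqf, hfq]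
    · intro i j
      cases i using Fin.cases <;> cases j using Fin.cases <;>
        simp [hef, hDq, hpf, hpq, Fin.succ_ne_zero, (Fin.succ_ne_zero _).symm]
    · intro i
      cases i using Fin.cases with
      | zero => simpa using heW
      | succ i => simpa using hpW i

/-- The standard symplectic form on `R ^ (2m)`, with matrix `Matrix.J`. -/
noncomputable abbrev sympForm (m : ℕ) (R : Type*) [CommRing R] :
    LinearMap.BilinForm R (Fin m ⊕ Fin m → R) :=
  Matrix.toBilin' (Matrix.J (Fin m) R)

theorem sympForm_apply {m : ℕ} {R : Type*} [CommRing R] (u v : Fin m ⊕ Fin m → R) :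
    sympForm m R u v =
      ∑ j, (u (Sum.inr j) * v (Sum.inl j) - u (Sum.inl j) * v (Sum.inr j)) := by
  simp [sympForm, Matrix.toBilin'_apply', Matrix.J, dotProduct, Matrix.fromBlocks_mulVec,
    Fintype.sum_sum_type, Finset.sum_sub_distrib, Matrix.neg_mulVec]
  ring

theorem map_sympForm {m : ℕ} {R S : Type*} [CommRing R] [CommRing S] (f : R →+* S)
    (u v : Fin m ⊕ Fin m → R) : f (sympForm m R u v) = sympForm m S (f ∘ u) (f ∘ v) := by
  simp [sympForm_apply]

theorem sympForm_isAlt (m : ℕ) (R : Type*) [CommRing R] : (sympForm m R).IsAlt := fun u => by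
  simp [sympForm_apply, mul_comm]

theorem sympForm_nondegenerate {m : ℕ} {R : Type*} [CommRing R] (u : Fin m ⊕ Fin m → R)
    (hu : ∀ v, sympForm m R u v = 0) : u = 0 := by
  ext (j | j)
  · simpa [sympForm_apply, Pi.single_apply] using hu (Pi.single (Sum.inr j) 1)
  · simpa [sympForm_apply, Pi.single_apply] using hu (Pi.single (Sum.inl j) 1)

theorem sympForm_mulVec {m : ℕ} {R : Type*} [CommRing R]
    {S : Matrix (Fin m ⊕ Fin m) (Fin m ⊕ Fin m) R} (hS : S ∈ Matrix.symplecticGroup (Fin m) R)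
    (u v : Fin m ⊕ Fin m → R) :
    sympForm m R (S.mulVec u) (S.mulVec v) = sympForm m R u v := by
  rw [Matrix.toBilin'_apply', Matrix.toBilin'_apply']
  conv_rhs => rw [← SymplecticGroup.mem_iff'.mp hS]
  rw [← Matrix.mulVec_mulVec, ← Matrix.mulVec_mulVec, Matrix.dotProduct_mulVec u,
    Matrix.vecMul_transpose]

/-- A vector over an extension of a finite field that is symplectically orthogonal to its first
`m` Frobenius twists is a combination of rational vectors spanning an isotropic subspace. -/
theorem exists_isotropic_family {F K : Type*} [Field F] [Fintype F] [Field K] [Algebra F K]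
    {m : ℕ} {w : Fin m ⊕ Fin m → K}
    (h : ∀ i ∈ Finset.Icc 1 m, sympForm m K w (fun k => w k ^ Fintype.card F ^ i) = 0) :
    ∃ (r : ℕ) (a : Fin r → K) (e : Fin r → Fin m ⊕ Fin m → F),
      (∀ i, w i = ∑ k, a k * algebraMap F K (e k i)) ∧
      ∀ k l, sympForm m F (e k) (e l) = 0 := by
  let φ : ℕ → K →ₐ[F] K := fun n => FiniteField.frobeniusAlgHom F K ^ n
  have hφ : ∀ n x, φ n x = x ^ Fintype.card F ^ n := fun n x => by
    simp only [φ, AlgHom.coe_pow, FiniteField.coe_frobeniusAlgHom, pow_iterate]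
  let W : Submodule F K := Submodule.span F (Set.range w)
  have : FiniteDimensional F W := FiniteDimensional.span_of_finite F (Set.finite_range w)
  let r := Module.finrank F W
  let b : Module.Basis (Fin r) F W := Module.finBasis F W
  let a : Fin r → K := fun k => b k
  have ha : LinearIndependent F a := b.linearIndependent.map' W.subtype W.ker_subtype
  have hr : r ≤ m + m := by
    simpa [Set.finrank] using finrank_range_le_card (R := F) w
  let e : Fin r → Fin m ⊕ Fin m → F :=
    fun k i => b.repr ⟨w i, Submodule.subset_span ⟨i, rfl⟩⟩ k
  have hw : ∀ i, w i = ∑ k, a k * algebraMap F K (e k i) := fun i => by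
    have := congrArg Subtype.val (b.sum_repr ⟨w i, Submodule.subset_span ⟨i, rfl⟩⟩)
    simp only [Submodule.coe_sum, Submodule.coe_smul, Algebra.smul_def] at this
    exact this.symm.trans (Finset.sum_congr rfl fun k _ => mul_comm _ _)
  let E : Fin r → Fin m ⊕ Fin m → K := fun k => algebraMap F K ∘ e k
  have hφE : ∀ n k, φ n ∘ E k = E k := fun n k => by ext i; simp [E]
  have hφw : ∀ n, φ n ∘ w = ∑ k, a k ^ Fintype.card F ^ n • E k := fun n => by
    ext i
    simp only [Function.comp_apply, hw i, map_sum, map_mul, AlgHom.commutes, hφ n (a _)]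
    simp [E]
  have hφB : ∀ n u v, φ n (sympForm m K u v) = sympForm m K (φ n ∘ u) (φ n ∘ v) :=
    fun n u v => map_sympForm (φ n).toRingHom u v
  have hle : ∀ i ≤ m, sympForm m K w (φ i ∘ w) = 0 := fun i hi => by
    rcases Nat.eq_zero_or_pos i with rfl | hi0
    · exact sympForm_isAlt m K w
    · rw [← h i (Finset.mem_Icc.mpr ⟨hi0, hi⟩)]
      congr 1
      ext k
      exact hφ i (w k)
  have hcomp : ∀ i j, φ i ∘ φ j ∘ w = φ (i + j) ∘ w := fun i j => by
    ext k
    simp only [Function.comp_apply, φ, pow_add, AlgHom.mul_apply]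
  have htwist : ∀ n < m + m + 1, sympForm m K (φ m ∘ w) (φ n ∘ w) = 0 := fun n hn => by
    rcases le_total m n with hmn | hmn
    · obtain ⟨i, rfl⟩ := Nat.exists_eq_add_of_le hmn
      rw [← hcomp, ← hφB, hle i (by omega), map_zero]
    · obtain ⟨i, rfl⟩ := Nat.exists_eq_add_of_le hmn
      rw [← hcomp, ← hφB, ← (sympForm_isAlt _ K).neg_eq, hle i (by omega), neg_zero, map_zero]
  have hmE : (fun l => sympForm m K (φ m ∘ w) (E l)) = 0 := by
    refine eq_zero_of_sum_mul_pow_card_pow_eq_zero ha (N := m + m + 1) (by simp; omega) ?_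
    intro n hn
    have := htwist n hn
    rw [hφw n, map_sum] at this
    simpa only [map_smul, smul_eq_mul, mul_comm] using this
  have hwE : ∀ l, sympForm m K w (E l) = 0 := fun l => by
    have := congrFun hmE l
    rw [← hφE m l, ← hφB] at this
    exact (map_eq_zero (φ m)).mp this
  refine ⟨r, a, e, hw, fun k l => ?_⟩
  refine Fintype.linearIndependent_iff.mp ha (fun k => sympForm m F (e k) (e l)) ?_ k
  have hw' : w = ∑ k, a k • E k := by
    ext i
    simp [hw i, E]
  have := hwE l
  rw [hw'] at this
  simp only [map_sum, map_smul, LinearMap.sum_apply, LinearMap.smul_apply, E, ← map_sympForm,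
    smul_eq_mul] at this
  simpa only [Algebra.smul_def, mul_comm] using this

/-- Every isotropic subspace is moved by a symplectic matrix into the standard Lagrangian where
the first `m` coordinates vanish. -/
theorem exists_mem_symplecticGroup_mulVec_inl_eq_zero {F : Type*} [Field F] {m : ℕ}
    (W : Submodule F (Fin m ⊕ Fin m → F)) (hW : ∀ x ∈ W, ∀ y ∈ W, sympForm m F x y = 0) :
    ∃ S ∈ Matrix.symplecticGroup (Fin m) F, ∀ u ∈ W, ∀ j, S.mulVec u (Sum.inl j) = 0 := by
  obtain ⟨p, q, hpp, hqq, hpq, hpW⟩ := exists_hyperbolic_family (sympForm m F)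
    (sympForm_isAlt m F) sympForm_nondegenerate W hW m (by simp; omega)
  have hqp : ∀ i j, sympForm m F (q i) (p j) = -if j = i then 1 else 0 := fun i j => by
    rw [← (sympForm_isAlt m F).neg_eq, hpq]
  let A : Matrix (Fin m ⊕ Fin m) (Fin m ⊕ Fin m) F := Matrix.of (Sum.elim (-p) q)
  have hA : A ∈ Matrix.symplecticGroup (Fin m) F := by
    rw [SymplecticGroup.mem_iff]
    ext i k
    have hik : (A * Matrix.J (Fin m) F * A.transpose) i k = sympForm m F (A i) (A k) := by
      rw [Matrix.toBilin'_apply', Matrix.mul_assoc]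
      rfl
    have hAl : ∀ i, A (Sum.inl i) = -p i := fun _ => rfl
    have hAr : ∀ i, A (Sum.inr i) = q i := fun _ => rfl
    rw [hik]
    rcases i with i | i <;> rcases k with k | k <;>
      simp [hAl, hAr, Matrix.J, hpp, hqq, hpq, hqp, Matrix.one_apply, eq_comm]
  refine ⟨A * Matrix.J (Fin m) F, mul_mem hA (SymplecticGroup.J_mem _ _), fun u hu j => ?_⟩
  have h := hpW j u hu
  rw [Matrix.toBilin'_apply'] at h
  rw [← Matrix.mulVec_mulVec]
  change (-p j) ⬝ᵥ _ = _
  rw [neg_dotProduct, h, neg_zero]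

/-- A function that is additive and quadratically homogeneous vanishes as soon as it does so on
the standard basis. -/
theorem eq_zero_of_additive_of_homogeneous {R ι : Type*} [CommRing R] [Fintype ι] [DecidableEq ι]
    (D : (ι → R) → R) (hadd : ∀ u v, D (u + v) = D u + D v)
    (hsmul : ∀ (c : R) u, D (c • u) = c ^ 2 * D u) (hsingle : ∀ i, D (Pi.single i 1) = 0)
    (u : ι → R) : D u = 0 := by
  have hsum : u = ∑ i, u i • (Pi.single i 1 : ι → R) := by
    simpa using (pi_eq_sum_univ' u)
  rw [hsum]
  refine (map_sum (AddMonoidHom.mk' D hadd) _ _).trans ?_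
  exact Finset.sum_eq_zero fun i _ => by simp [hsmul, hsingle]

/-- The split quadratic form `∑ x_j y_j`. -/
def hyperbolicForm {m : ℕ} {R : Type*} [CommRing R] (u : Fin m ⊕ Fin m → R) : R :=
  ∑ j, u (Sum.inr j) * u (Sum.inl j)

theorem hyperbolicForm_add {m : ℕ} {R : Type*} [CommRing R] [CharP R 2]
    (u v : Fin m ⊕ Fin m → R) :
    hyperbolicForm (u + v) = hyperbolicForm u + hyperbolicForm v + sympForm m R u v := by
  simp only [hyperbolicForm, sympForm_apply, ← Finset.sum_add_distrib, Pi.add_apply,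
    CharTwo.sub_eq_add]
  exact Finset.sum_congr rfl fun j _ => by ring

theorem hyperbolicForm_smul {m : ℕ} {R : Type*} [CommRing R] (c : R) (u : Fin m ⊕ Fin m → R) :
    hyperbolicForm (c • u) = c ^ 2 * hyperbolicForm u := by
  simp only [hyperbolicForm, Finset.mul_sum, Pi.smul_apply, smul_eq_mul]
  exact Finset.sum_congr rfl fun j _ => by ring

/-- In characteristic two, a symplectic matrix preserves `∑ x_j y_j` up to the square of a linear
form. -/
theorem sq_sum_add_hyperbolicForm_mulVec {m : ℕ} {R : Type*} [CommRing R] [CharP R 2]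
    {S : Matrix (Fin m ⊕ Fin m) (Fin m ⊕ Fin m) R} (hS : S ∈ Matrix.symplecticGroup (Fin m) R)
    {a : Fin m ⊕ Fin m → R} (ha : ∀ k, a k ^ 2 = ∑ j, S (Sum.inr j) k * S (Sum.inl j) k)
    (u : Fin m ⊕ Fin m → R) :
    (a ⬝ᵥ u) ^ 2 + hyperbolicForm (S.mulVec u) = hyperbolicForm u := by
  rw [← CharTwo.sub_eq_add, ← sub_eq_zero, sub_sub, CharTwo.sub_eq_add]
  refine eq_zero_of_additive_of_homogeneous
    (fun u => (a ⬝ᵥ u) ^ 2 + (hyperbolicForm (S.mulVec u) + hyperbolicForm u)) ?_ ?_ ?_ u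
  · intro u v
    simp only [dotProduct_add, Matrix.mulVec_add, hyperbolicForm_add, CharTwo.add_sq,
      sympForm_mulVec hS]
    linear_combination CharTwo.add_self_eq_zero (sympForm m R u v)
  · intro c u
    simp only [dotProduct_smul, Matrix.mulVec_smul, hyperbolicForm_smul, smul_eq_mul]
    ring
  · intro k
    have h0 : hyperbolicForm (Pi.single k 1 : Fin m ⊕ Fin m → R) = 0 := by
      rcases k with k | k <;> simp [hyperbolicForm]
    simp only [h0, add_zero, dotProduct_single, mul_one, ha]
    simp [hyperbolicForm, CharTwo.add_self_eq_zero]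

theorem act_X {F : Type*} [Field F] {ι : Type*} [Fintype ι] [DecidableEq ι]
    (g : (ι → F) ≃ₗ[F] (ι → F)) (i : ι) :
    act g (X i) = ∑ k, C (g (Pi.single k 1) i) * X k :=
  aeval_X _ _

/-- In characteristic two over a field where all elements are squares, symplectic matrices lift
to isometries of `ξ_0`. -/
theorem exists_act_xiZero_eq_self {F : Type*} [Field F] [CharP F 2]
    (hsq : ∀ x : F, IsSquare x) {m : ℕ} {S : Matrix (Fin m ⊕ Fin m) (Fin m ⊕ Fin m) F}
    (hS : S ∈ Matrix.symplecticGroup (Fin m) F) :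
    ∃ g : (OIdx m → F) ≃ₗ[F] (OIdx m → F), act g (xiZero m F) = xiZero m F ∧
      ∀ i, act g (X (some i)) = ∑ k, C (S i k) * X (some k) := by
  choose a ha using fun k => hsq (∑ j, S (Sum.inr j) k * S (Sum.inl j) k)
  let G : (OIdx m → F) →ₗ[F] (OIdx m → F) := LinearMap.pi fun i => i.elim
    (LinearMap.proj none + ∑ k, a k • LinearMap.proj (some k))
    fun i => ∑ k, S i k • LinearMap.proj (some k)
  have hGn : ∀ v, G v none = v none + ∑ k, a k * v (some k) := fun v => by simp [G]
  have hGs : ∀ v i, G v (some i) = S.mulVec (v ∘ some) i := fun v i => by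
    simp [G, Matrix.mulVec, dotProduct]
  have hG : Function.Injective G := by
    rw [← LinearMap.ker_eq_bot, LinearMap.ker_eq_bot']
    intro v hv
    have hvs : v ∘ some = 0 := by
      refine Matrix.mulVec_injective_iff_isUnit.mpr
        ((Matrix.isUnit_iff_isUnit_det S).mpr (SymplecticGroup.symplectic_det hS)) ?_
      ext i
      rw [← hGs, hv, Matrix.mulVec_zero]
      rfl
    have hvs' : ∀ k, v (some k) = 0 := congrFun hvs
    ext i
    cases i with
    | none => simpa [hGn, hvs'] using congrFun hv none
    | some i => exact hvs' i
  let g := LinearEquiv.ofInjectiveEndo G hG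
  have hg : ∀ v, g v = G v := fun v => rfl
  have hgs : ∀ i, act g (X (some i)) = ∑ k, C (S i k) * X (some k) := fun i => by
    have h0 : (Pi.single none 1 : OIdx m → F) ∘ some = 0 := by ext; simp
    have h1 : ∀ k, (Pi.single (some k) 1 : OIdx m → F) ∘ some = Pi.single k 1 := fun k => by
      ext; simp [Pi.single_apply]
    rw [act_X, Fintype.sum_option]
    simp [hg, hGs, h0, h1]
  have hgn : act g (X none) = X none + ∑ k, C (a k) * X (some k) := by
    rw [act_X, Fintype.sum_option]
    simp [hg, hGn, Pi.single_apply]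
  refine ⟨g, ?_, hgs⟩
  have key := sq_sum_add_hyperbolicForm_mulVec (R := MvPolynomial (OIdx m) F)
    (SymplecticGroup.map_mem hS (C (σ := OIdx m))) (a := fun k => C (a k))
    (fun k => by simpa [sq] using (congrArg (C (σ := OIdx m)) (ha k)).symm) (fun k => X (some k))
  simp only [hyperbolicForm, Matrix.mulVec, dotProduct, Matrix.map_apply] at key
  simp only [xiZero, map_add, map_pow, map_sum, map_mul, hgs, hgn, CharTwo.add_sq, add_assoc, key]

/-- Polarizing `ξ_0` shows that its isometries preserve the symplectic form on points. -/
theorem sympForm_aeval_act {F K : Type*} [Field F] [Field K] [Algebra F K] [CharP K 2] {m : ℕ}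
    {g : (OIdx m → F) ≃ₗ[F] (OIdx m → F)} (hg : act g (xiZero m F) = xiZero m F)
    (u v : OIdx m → K) :
    sympForm m K (fun i => aeval u (act g (X (some i)))) (fun i => aeval v (act g (X (some i)))) =
      sympForm m K (u ∘ some) (v ∘ some) := by
  let G : (OIdx m → K) → OIdx m → K := fun u i => aeval u (act g (X i))
  have hGadd : G (u + v) = G u + G v := by
    ext i
    simp only [G, act_X, map_sum, map_mul, aeval_X, algHom_C, Pi.add_apply, mul_add,
      Finset.sum_add_distrib]
  let Q : (OIdx m → K) → K := fun u => u none ^ 2 + hyperbolicForm (u ∘ some)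
  have hQ : ∀ u, aeval u (xiZero m F) = Q u := fun u => by
    simp [xiZero, Q, hyperbolicForm]
  have hQG : ∀ u, Q (G u) = Q u := fun u => by
    rw [← hQ u, ← hg]
    simp [xiZero, Q, G, hyperbolicForm]
  have hpolar : ∀ u v, Q (u + v) = Q u + Q v + sympForm m K (u ∘ some) (v ∘ some) := fun u v => by
    have h := hyperbolicForm_add (u ∘ some) (v ∘ some)
    simp only [Q, Pi.add_apply, CharTwo.add_sq, Pi.add_comp, h]
    ring
  have h := hpolar (G u) (G v)
  rw [← hGadd, hQG, hQG, hQG, hpolar] at h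
  exact (add_left_cancel h).symm

theorem aeval_xiGen {F K : Type*} [Field F] [Field K] [Algebra F K] [CharP K 2] (q m i : ℕ)
    (v : OIdx m → K) :
    aeval v (xiGen q m F i) = sympForm m K (v ∘ some) (fun k => v (some k) ^ q ^ i) := by
  simp [xiGen, sympForm_apply, CharTwo.sub_eq_add]

/-- `V(ξ_1,…,ξ_m) = ∪_{g ∈ O_{2m+1}(F_q)} g·V(y_1,…,y_m)` over the algebraic
closure: a point `v` kills `ξ_1,…,ξ_m` iff, for some `g` preserving `ξ_0`,
all the transformed coordinate functions `y_j·g` vanish at `v`. -/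
theorem stmt_18 {F : Type*} [Field F] [Fintype F] (s m q : ℕ) (hs : 1 ≤ s)
    (hq : q = 2 ^ s) (hF : Fintype.card F = q)
    (v : OIdx m → AlgebraicClosure F) :
    (∀ i ∈ Finset.Icc 1 m, MvPolynomial.aeval v (xiGen q m F i) = 0) ↔
    ∃ g : (OIdx m → F) ≃ₗ[F] (OIdx m → F),
      act g (xiZero m F) = xiZero m F ∧
      ∀ j : Fin m,
        MvPolynomial.aeval v (act g (X (some (Sum.inl j)) : MvPolynomial (OIdx m) F)) = 0 := by
  have : CharP F 2 := charP_of_card_eq_prime_pow (hF.trans hq)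
  have : CharP (AlgebraicClosure F) 2 := charP_of_injective_algebraMap' F 2
  subst hF
  simp only [aeval_xiGen]
  constructor
  · intro h
    obtain ⟨r, a, e, hv, he⟩ := exists_isotropic_family h
    obtain ⟨S, hS, hSe⟩ := exists_mem_symplecticGroup_mulVec_inl_eq_zero
      (Submodule.span F (Set.range e)) (fun x hx y hy => by
        induction hx, hy using Submodule.span_induction₂ with
        | mem_mem x y hx hy =>
          obtain ⟨k, rfl⟩ := hx
          obtain ⟨l, rfl⟩ := hy
          exact he k l
        | zero_left | zero_right => simp
        | add_left | add_right | smul_left | smul_right => simp [*])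
    obtain ⟨g, hg, hgS⟩ := exists_act_xiZero_eq_self
      (FiniteField.isSquare_of_char_two (CharP.eq F (ringChar.charP F) ‹_›)) hS
    refine ⟨g, hg, fun j => ?_⟩
    have hSe' : ∀ k, ∑ i, S (Sum.inl j) i * e k i = 0 := fun k =>
      hSe (e k) (Submodule.subset_span ⟨k, rfl⟩) j
    simp only [Function.comp_apply] at hv
    simp only [hgS, map_sum, map_mul, aeval_X, algHom_C, hv, Finset.mul_sum]
    rw [Finset.sum_comm]
    refine Finset.sum_eq_zero fun k _ => ?_
    calc _ = a k * algebraMap F _ (∑ i, S (Sum.inl j) i * e k i) := by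
          simp only [map_sum, map_mul, Finset.mul_sum, mul_left_comm]
      _ = 0 := by rw [hSe', map_zero, mul_zero]
  · rintro ⟨g, hg, hgv⟩ i hi
    let φ := FiniteField.frobeniusAlgHom F (AlgebraicClosure F) ^ i
    have hφ : ∀ x, φ x = x ^ Fintype.card F ^ i := fun x => by
      simp only [φ, AlgHom.coe_pow, FiniteField.coe_frobeniusAlgHom, pow_iterate]
    have h := sympForm_aeval_act hg v (φ ∘ v)
    have hcomp : ∀ p : MvPolynomial (OIdx m) F, aeval (φ ∘ v) p = φ (aeval v p) := fun p =>
      (comp_aeval_apply v φ p).symm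
    simp only [hcomp] at h
    have hφv : (φ ∘ v) ∘ some = fun k => v (some k) ^ Fintype.card F ^ i :=
      funext fun k => hφ _
    rw [← hφv, ← h, sympForm_apply]
    exact Finset.sum_eq_zero fun j _ => by rw [hgv, map_zero, mul_zero, zero_mul, sub_zero]
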